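/- arXiv:1604.00616 — 2 statements merged into one kernel-verified Lean document; each statement's English description precedes it below -/
import Mathlib

section
/- Let n be a natural number and assume f : ℝ^d → ℂ is a continuous function satisfying the Popoviciu–Ionescu functional equation of order n in ℝ^d: for all x, h ∈ ℝ^d, det[f(x + (i + j)h)]_{0 ≤ i, j ≤ n} = 0. Then the restriction of f to any line is an exponential polynomial: for every x_0, h_0 ∈ ℝ^d, the function F(t) = f(x_0 + t·h_0) of the real variable t is an exponential polynomial, i.e., there are finitely many λ_j ∈ ℂ and polynomials P_j ∈ ℂ[X] with F(t) = Σ_j P_j(t)·exp(λ_j t) for all t ∈ ℝ. -/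
open scoped BigOperators

/-- The `r × r` Hankel matrix of `a` starting at `m` is singular. -/
def HSing (a : ℤ → ℂ) (r : ℕ) (m : ℤ) : Prop :=
  ∃ v : ℕ → ℂ, (∃ j < r, v j ≠ 0) ∧
    ∀ i < r, ∑ j ∈ Finset.range r, v j * a (m + (i : ℕ) + (j : ℕ)) = 0

theorem HSing.not_iff {a : ℤ → ℂ} {r : ℕ} {m : ℤ} (h : ¬ HSing a r m) (v : ℕ → ℂ)
    (hv : ∀ i < r, ∑ j ∈ Finset.range r, v j * a (m + (i : ℕ) + (j : ℕ)) = 0) :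
    ∀ j < r, v j = 0 := by
  intro j hj
  by_contra hne
  exact h ⟨v, ⟨j, hj, hne⟩, hv⟩

/-- shift of rows -/
theorem hrow {a : ℤ → ℂ} {r : ℕ} {m : ℤ} {c : ℕ → ℂ}
    (hc : ∀ i < r + 1, ∑ j ∈ Finset.range (r + 1), c j * a (m + (i : ℕ) + (j : ℕ)) = 0) :
    ∀ i < r, ∑ j ∈ Finset.range (r + 1), c j * a (m + 1 + (i : ℕ) + (j : ℕ)) = 0 := by
  intro i hi
  rw [← hc (i + 1) (by omega)]
  refine Finset.sum_congr rfl fun j _ => ?_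
  congr 2
  push_cast; ring

theorem htail {a : ℤ → ℂ} {r : ℕ} {m : ℤ} {c : ℕ → ℂ} (h0 : c 0 = 0)
    (hc : ∀ i < r, ∑ j ∈ Finset.range (r + 1), c j * a (m + (i : ℕ) + (j : ℕ)) = 0) :
    ∀ i < r, ∑ j ∈ Finset.range r, c (j + 1) * a (m + 1 + (i : ℕ) + (j : ℕ)) = 0 := by
  intro i hi
  have := hc i hi
  rw [Finset.sum_range_succ', h0, zero_mul, add_zero] at this
  rw [← this]
  refine Finset.sum_congr rfl fun j _ => ?_
  congr 2
  push_cast; ring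

theorem hhead {a : ℤ → ℂ} {r : ℕ} {m : ℤ} {c : ℕ → ℂ} (h0 : c r = 0)
    (hc : ∀ i < r, ∑ j ∈ Finset.range (r + 1), c j * a (m + (i : ℕ) + (j : ℕ)) = 0) :
    ∀ i < r, ∑ j ∈ Finset.range r, c j * a (m + (i : ℕ) + (j : ℕ)) = 0 := by
  intro i hi
  have := hc i hi
  rwa [Finset.sum_range_succ, h0, zero_mul, add_zero] at this

theorem hcomb {a : ℤ → ℂ} {r s : ℕ} {m : ℤ} {c u : ℕ → ℂ} (α β : ℂ)
    (hc : ∀ i < r, ∑ j ∈ Finset.range s, c j * a (m + (i : ℕ) + (j : ℕ)) = 0)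
    (hu : ∀ i < r, ∑ j ∈ Finset.range s, u j * a (m + (i : ℕ) + (j : ℕ)) = 0) :
    ∀ i < r, ∑ j ∈ Finset.range s, (α * c j - β * u j) * a (m + (i : ℕ) + (j : ℕ)) = 0 := by
  intro i hi
  have : ∑ j ∈ Finset.range s, (α * c j - β * u j) * a (m + (i : ℕ) + (j : ℕ))
      = α * ∑ j ∈ Finset.range s, c j * a (m + (i : ℕ) + (j : ℕ))
        - β * ∑ j ∈ Finset.range s, u j * a (m + (i : ℕ) + (j : ℕ)) := by
    rw [Finset.mul_sum, Finset.mul_sum, ← Finset.sum_sub_distrib]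
    exact Finset.sum_congr rfl fun j _ => by ring
  rw [this, hc i hi, hu i hi]; simp

theorem HSing.down {a : ℤ → ℂ} {r : ℕ} {m : ℤ} (h1 : HSing a (r + 1) m)
    (h2 : HSing a r (m + 1 + 1)) : HSing a r (m + 1) := by
  by_contra hN
  obtain ⟨c, ⟨j0, hj0, hcj⟩, hc⟩ := h1
  obtain ⟨u, ⟨j1, hj1, huj⟩, hu⟩ := h2
  let u' : ℕ → ℂ := fun j => if j = 0 then 0 else u (j - 1)
  have hu' : ∀ i < r, ∑ j ∈ Finset.range (r + 1), u' j * a (m + 1 + (i : ℕ) + (j : ℕ)) = 0 := by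
    intro i hi
    rw [Finset.sum_range_succ', ← hu i hi]
    simp only [u']
    simp only [if_true, zero_mul, add_zero]
    refine Finset.sum_congr rfl fun j _ => ?_
    simp only [Nat.add_eq_zero_iff, one_ne_zero, and_false, if_false, Nat.add_sub_cancel]
    congr 2
    push_cast; ring
  have hc1 := hrow hc
  have hur : u' r ≠ 0 := by
    intro h0
    have h3 := HSing.not_iff hN u' (hhead h0 hu')
    apply huj
    have h4 : u j1 = u' (j1 + 1) := by simp [u']
    rw [h4]
    rcases Nat.lt_or_ge (j1 + 1) r with h | h
    · exact h3 _ h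
    · rw [show j1 + 1 = r by omega, h0]
  have h5 := HSing.not_iff hN _ (hhead (c := fun j => u' r * c j - c r * u' j) (by ring)
    (hcomb (u' r) (c r) hc1 hu'))
  have h6 : c 0 = 0 := by
    have := h5 0 (by omega)
    have h8 : u' 0 = 0 := rfl
    rw [h8, mul_zero, sub_zero] at this
    exact (mul_eq_zero.1 this).resolve_left hur
  have h7 := HSing.not_iff hN _ (htail h6 (fun i hi => hc i (by omega)))
  apply hcj
  rcases j0 with _ | j0
  · exact h6
  · exact h7 j0 (by omega)

theorem HSing.up {a : ℤ → ℂ} {r : ℕ} {m : ℤ} (h1 : HSing a (r + 1) m)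
    (h2 : HSing a r m) : HSing a r (m + 1) := by
  by_contra hN
  obtain ⟨c, ⟨j0, hj0, hcj⟩, hc⟩ := h1
  obtain ⟨u, ⟨j1, hj1, huj⟩, hu⟩ := h2
  let u' : ℕ → ℂ := fun j => if j < r then u j else 0
  have hu'r : u' r = 0 := by simp [u']
  have hu' : ∀ i < r, ∑ j ∈ Finset.range (r + 1), u' j * a (m + (i : ℕ) + (j : ℕ)) = 0 := by
    intro i hi
    rw [Finset.sum_range_succ, ← hu i hi, hu'r, zero_mul, add_zero]
    refine Finset.sum_congr rfl fun j hj => ?_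
    simp [u', Finset.mem_range.1 hj]
  have hc1 : ∀ i < r, ∑ j ∈ Finset.range (r + 1), c j * a (m + (i : ℕ) + (j : ℕ)) = 0 :=
    fun i hi => hc i (by omega)
  have hu0 : u' 0 ≠ 0 := by
    intro h0
    have h3 := HSing.not_iff hN _ (htail h0 hu')
    apply huj
    have h4 : u j1 = u' j1 := by simp [u', hj1]
    rw [h4]
    rcases j1 with _ | j1
    · exact h0
    · exact h3 j1 (by omega)
  have h5 := HSing.not_iff hN _ (htail (c := fun j => u' 0 * c j - c 0 * u' j) (by ring)
    (hcomb (u' 0) (c 0) hc1 hu'))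
  have h6 : c r = 0 := by
    have := h5 (r - 1) (by omega)
    rw [Nat.sub_add_cancel (by omega)] at this
    simpa [hu'r, hu0] using this
  have h7 := HSing.not_iff hN _ (hhead h6 (hrow hc))
  apply hcj
  rcases Nat.lt_or_ge j0 r with h | h
  · exact h7 _ h
  · rw [show j0 = r by omega, h6]

theorem int_all {p : ℤ → Prop} (h : ∀ m, p m ↔ p (m + 1)) {k : ℤ} (hk : p k) : ∀ m, p m := by
  intro m
  have : ∀ n : ℤ, p (k + n) := by
    intro n
    induction n using Int.induction_on with
    | zero => simpa using hk
    | succ i ih => rw [← add_assoc]; exact (h _).1 ih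
    | pred i ih => exact (h _).2 (by convert ih using 1; ring)
  convert this (m - k) using 1; ring

theorem exists_rec {a : ℤ → ℂ} {n : ℕ} (h : ∀ m, HSing a (n + 1) m) :
    ∃ r ≤ n, ∃ c : ℕ → ℂ, c r ≠ 0 ∧ c 0 ≠ 0 ∧
      ∀ m : ℤ, ∑ j ∈ Finset.range (r + 1), c j * a (m + (j : ℕ)) = 0 := by
  have hex : ∃ r ≤ n, (∀ m, HSing a (r + 1) m) ∧ ¬ ∀ m, HSing a r m := by
    induction n with
    | zero =>
      refine ⟨0, le_rfl, h, fun h0 => ?_⟩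
      obtain ⟨v, ⟨j, hj, _⟩, _⟩ := h0 0
      omega
    | succ n ih =>
      by_cases h' : ∀ m, HSing a (n + 1) m
      · obtain ⟨r, hr, h2⟩ := ih h'
        exact ⟨r, by omega, h2⟩
      · exact ⟨n + 1, le_rfl, h, h'⟩
  obtain ⟨r, hr, h1, h0⟩ := hex
  push Not at h0
  obtain ⟨k, hk⟩ := h0
  have hN : ∀ m, ¬ HSing a r m := by
    refine int_all (fun m => not_congr ⟨fun h => (h1 m).up h, fun h => ?_⟩) hk
    have := (h1 (m - 1)).down (r := r) (by convert h using 1; ring)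
    simpa using this
  have hnorm : ∀ m, ∃ c : ℕ → ℂ, c r = 1 ∧ ∀ i < r + 1,
      ∑ j ∈ Finset.range (r + 1), c j * a (m + (i : ℕ) + (j : ℕ)) = 0 := by
    intro m
    obtain ⟨c, ⟨j0, hj0, hcj⟩, hc⟩ := h1 m
    have hcr : c r ≠ 0 := by
      intro h0
      have h7 := HSing.not_iff (hN m) _ (hhead h0 (fun i hi => hc i (by omega)))
      apply hcj
      rcases Nat.lt_or_ge j0 r with h | h
      · exact h7 _ h
      · rw [show j0 = r by omega, h0]
    refine ⟨fun j => (c r)⁻¹ * c j, by simp [hcr], fun i hi => ?_⟩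
    have := hc i hi
    simp only [mul_assoc]
    rw [← Finset.mul_sum, this, mul_zero]
  obtain ⟨c, hcr, hc⟩ := hnorm 0
  have hstep : ∀ m (c c' : ℕ → ℂ), c r = 1 → c' r = 1 →
      (∀ i < r + 1, ∑ j ∈ Finset.range (r + 1), c j * a (m + (i : ℕ) + (j : ℕ)) = 0) →
      (∀ i < r + 1, ∑ j ∈ Finset.range (r + 1), c' j * a (m + 1 + (i : ℕ) + (j : ℕ)) = 0) →
      ∀ j < r + 1, c j = c' j := by
    intro m c c' h h' hc hc' j hj
    have h5 := HSing.not_iff (hN (m + 1)) _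
      (hhead (c := fun j => 1 * c j - 1 * c' j) (by simp [h, h'])
      (hcomb 1 1 (hrow hc) (fun i hi => hc' i (by omega))))
    rcases Nat.lt_or_ge j r with h6 | h6
    · have := h5 j h6
      simpa [sub_eq_zero] using this
    · rw [show j = r by omega, h, h']
  have hall := int_all (p := fun m => ∀ i < r + 1,
      ∑ j ∈ Finset.range (r + 1), c j * a (m + (i : ℕ) + (j : ℕ)) = 0) (by
    intro m
    constructor
    · intro hm
      obtain ⟨c', hcr', hc'⟩ := hnorm (m + 1)
      have := hstep m c c' hcr hcr' hm hc'
      intro i hi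
      rw [← hc' i hi]
      exact Finset.sum_congr rfl fun j hj => by rw [this j (Finset.mem_range.1 hj)]
    · intro hm
      obtain ⟨c', hcr', hc'⟩ := hnorm m
      have := hstep m c' c hcr' hcr hc' hm
      intro i hi
      rw [← hc' i hi]
      exact Finset.sum_congr rfl fun j hj => by rw [this j (Finset.mem_range.1 hj)]) hc
  refine ⟨r, hr, c, by simp [hcr], ?_, fun m => by simpa using hall m 0 (by omega)⟩
  intro h0
  have h3 := HSing.not_iff (hN (0 + 1)) _ (htail h0 (fun i hi => hc i (by omega)))
  rcases r with _ | r
  · rw [h0] at hcr; exact zero_ne_one hcr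
  · have := h3 r (by omega)
    rw [this] at hcr; exact zero_ne_one hcr

theorem rec_zero {b : ℤ → ℂ} {r : ℕ} {c : ℕ → ℂ} (hr : c r ≠ 0) (h0 : c 0 ≠ 0)
    (h : ∀ m : ℤ, ∑ j ∈ Finset.range (r + 1), c j * b (m + (j : ℕ)) = 0)
    (hb : ∀ k < r, b (k : ℕ) = 0) : ∀ m, b m = 0 := by
  have key : ∀ m : ℤ, ∀ k < r, b (m + (k : ℕ)) = 0 := by
    refine int_all (k := 0) (fun m => ⟨fun hm k hk => ?_, fun hm k hk => ?_⟩) (by simpa using hb)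
    · rcases Nat.lt_or_ge (k + 1) r with h' | h'
      · rw [← hm _ h']; congr 1; push_cast; ring
      · have h1 := h m
        rw [Finset.sum_range_succ, Finset.sum_eq_zero, zero_add] at h1
        · rw [show m + 1 + (k : ℤ) = m + (r : ℕ) by
            rw [show r = k + 1 by omega]; push_cast; ring]
          simpa [hr] using h1
        · intro j hj
          rw [hm j (Finset.mem_range.1 hj), mul_zero]
    · rcases k with _ | k
      · have h1 := h m
        rw [Finset.sum_range_succ', Finset.sum_eq_zero, zero_add] at h1
        · simpa [h0] using h1
        · intro j hj
          have := hm j (Finset.mem_range.1 hj)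
          rw [show m + ((j + 1 : ℕ) : ℤ) = m + 1 + (j : ℕ) by push_cast; ring, this, mul_zero]
      · rw [← hm k (by omega)]; congr 1; push_cast; ring
  intro m
  rcases r with _ | r
  · simpa [h0] using h m
  · simpa using key m 0 (by omega)

theorem det_shift {a : ℤ → ℂ} {n : ℕ}
    (h : ∀ m : ℤ, Matrix.det (Matrix.of fun i j : Fin (n + 1) =>
      a (m + ((i : ℕ) : ℤ) + ((j : ℕ) : ℤ))) = 0)
    (p q : Fin (n + 1) → ℤ) :
    Matrix.det (Matrix.of fun i j : Fin (n + 1) => a (p i + q j)) = 0 := by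
  have hs : ∀ m, HSing a (n + 1) m := by
    intro m
    obtain ⟨v, hv, hv0⟩ := Matrix.exists_mulVec_eq_zero_iff.2 (h m)
    refine ⟨fun j => if hj : j < n + 1 then v ⟨j, hj⟩ else 0, ?_, ?_⟩
    · obtain ⟨j, hj⟩ := Function.ne_iff.1 hv
      exact ⟨j, j.2, by simpa [j.is_le] using hj⟩
    · intro i hi
      have := congrFun hv0 ⟨i, hi⟩
      rw [Finset.sum_range]
      simp only [Matrix.mulVec, dotProduct, Matrix.of_apply, Pi.zero_apply] at this
      refine Eq.trans ?_ this
      exact Finset.sum_congr rfl fun j _ => by simp only [Fin.is_lt, dite_true, Fin.eta, mul_comm]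
  obtain ⟨r, hr, c, hcr, hc0, hc⟩ := exists_rec hs
  -- a combination of shifts vanishing at `r` points
  let L : (Fin (n + 1) → ℂ) →ₗ[ℂ] (Fin r → ℂ) :=
    Matrix.mulVecLin (Matrix.of fun (k : Fin r) (i : Fin (n + 1)) => a (p i + ((k : ℕ) : ℤ)))
  have hL : LinearMap.ker L ≠ ⊥ := by
    apply LinearMap.ker_ne_bot_of_finrank_lt
    simp; omega
  obtain ⟨w, hw, hw0⟩ := (Submodule.ne_bot_iff _).1 hL
  have hb := rec_zero (b := fun m => ∑ i, a (p i + m) * w i) hcr hc0 (by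
      intro m
      simp only [Finset.mul_sum]
      rw [Finset.sum_comm]
      apply Finset.sum_eq_zero
      intro i _
      have := hc (p i + m)
      calc _ = (∑ j ∈ Finset.range (r + 1), c j * a (p i + m + (j : ℕ))) * w i := by
            rw [Finset.sum_mul]
            exact Finset.sum_congr rfl fun j _ => by rw [add_assoc]; ring
        _ = 0 := by rw [this, zero_mul]) (by
      intro k hk
      have := congrFun (LinearMap.mem_ker.1 hw) ⟨k, hk⟩
      simpa [L, Matrix.mulVec, dotProduct] using this)
  rw [← Matrix.exists_vecMul_eq_zero_iff]
  refine ⟨w, hw0, ?_⟩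
  ext j
  simpa [Matrix.vecMul, dotProduct, mul_comm] using hb (q j)

theorem det_all {F : ℝ → ℂ} (hF : Continuous F) {n : ℕ}
    (h : ∀ x s : ℝ, Matrix.det (Matrix.of fun i j : Fin (n + 1) =>
      F (x + ((i : ℕ) + (j : ℕ)) * s)) = 0)
    (p q : Fin (n + 1) → ℝ) :
    Matrix.det (Matrix.of fun i j : Fin (n + 1) => F (p i + q j)) = 0 := by
  have happ : ∀ x : ℝ, Filter.Tendsto (fun N : ℕ => (⌊x * N⌋ : ℝ) * (N : ℝ)⁻¹) Filter.atTop (nhds x) := by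
    intro x
    rw [tendsto_iff_dist_tendsto_zero]
    refine squeeze_zero' (Filter.Eventually.of_forall fun _ => dist_nonneg) ?_
      (tendsto_inv_atTop_nhds_zero_nat (𝕜 := ℝ))
    filter_upwards [Filter.eventually_gt_atTop 0] with N hN
    have hN' : (0 : ℝ) < N := by exact_mod_cast hN
    have e : (⌊x * N⌋ : ℝ) * (N : ℝ)⁻¹ - x = ((⌊x * N⌋ : ℝ) - x * N) * (N : ℝ)⁻¹ := by
      field_simp
    rw [Real.dist_eq, e, abs_mul, abs_of_pos (inv_pos.2 hN')]
    have h1 := Int.floor_le (x * N)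
    have h2 := Int.lt_floor_add_one (x * N)
    have h3 : |(⌊x * N⌋ : ℝ) - x * N| ≤ 1 := by rw [abs_le]; constructor <;> linarith
    have := inv_pos.2 hN'
    nlinarith
  have hlim : Filter.Tendsto (fun N : ℕ => Matrix.det (Matrix.of fun i j : Fin (n + 1) =>
      F ((⌊p i * N⌋ : ℝ) * (N : ℝ)⁻¹ + (⌊q j * N⌋ : ℝ) * (N : ℝ)⁻¹))) Filter.atTop
      (nhds (Matrix.det (Matrix.of fun i j : Fin (n + 1) => F (p i + q j)))) := by
    have hdet : Continuous (fun M : Matrix (Fin (n + 1)) (Fin (n + 1)) ℂ => M.det) :=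
      Continuous.matrix_det continuous_id
    refine (hdet.tendsto _).comp ?_
    refine tendsto_pi_nhds.2 fun i => tendsto_pi_nhds.2 fun j => ?_
    exact (hF.tendsto _).comp ((happ _).add (happ _))
  refine tendsto_nhds_unique hlim ?_
  refine tendsto_const_nhds.congr fun N => ?_
  symm
  have := det_shift (a := fun k => F (k * (N : ℝ)⁻¹)) (n := n) (fun m => by
    have := h (m * (N : ℝ)⁻¹) (N : ℝ)⁻¹
    rw [← this]
    congr 2
    ext i j
    congr 1
    push_cast; ring) (fun i => ⌊p i * N⌋) (fun j => ⌊q j * N⌋)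
  rw [← this]
  congr 2
  ext i j
  congr 1
  push_cast; ring

/-- translates span a finite-dimensional space -/
theorem exists_translates {F : ℝ → ℂ} {n : ℕ}
    (h : ∀ p q : Fin (n + 1) → ℝ,
      Matrix.det (Matrix.of fun i j : Fin (n + 1) => F (p i + q j)) = 0) :
    ∃ (r : ℕ) (p : Fin r → ℝ), ∀ t : ℝ, ∃ c : Fin r → ℂ,
      ∀ s, F (t + s) = ∑ i, c i * F (p i + s) := by
  have hex : ∃ r, (∀ p q : Fin (r + 1) → ℝ,
      Matrix.det (Matrix.of fun i j : Fin (r + 1) => F (p i + q j)) = 0) ∧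
      ∃ p q : Fin r → ℝ, Matrix.det (Matrix.of fun i j : Fin r => F (p i + q j)) ≠ 0 := by
    induction n with
    | zero => exact ⟨0, h, 0, 0, by simp⟩
    | succ n ih =>
      by_cases h' : ∀ p q : Fin (n + 1) → ℝ,
        Matrix.det (Matrix.of fun i j : Fin (n + 1) => F (p i + q j)) = 0
      · exact ih h'
      · push Not at h'
        exact ⟨n + 1, h, h'⟩
  obtain ⟨r, h1, p, q, hpq⟩ := hex
  refine ⟨r, p, fun t => ?_⟩
  set M : Matrix (Fin r) (Fin r) ℂ := Matrix.of fun i j : Fin r => F (p i + q j) with hM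
  have hu : IsUnit M.det := isUnit_iff_ne_zero.2 hpq
  have : Invertible M := Matrix.invertibleOfIsUnitDet _ hu
  let C : Matrix (Fin 1) (Fin r) ℂ := Matrix.of fun _ j => F (t + q j)
  refine ⟨(C * ⅟M) 0, fun s => ?_⟩
  let B : Matrix (Fin r) (Fin 1) ℂ := Matrix.of fun i _ => F (p i + s)
  let D : Matrix (Fin 1) (Fin 1) ℂ := Matrix.of fun _ _ => F (t + s)
  have hd : (Matrix.fromBlocks M B C D).det = 0 := by
    have := h1 (Sum.elim p (fun _ => t) ∘ finSumFinEquiv.symm)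
      (Sum.elim q (fun _ => s) ∘ finSumFinEquiv.symm)
    rw [← Matrix.det_submatrix_equiv_self (finSumFinEquiv (m := r) (n := 1))] at this
    rw [← this]
    congr 1
    ext i j
    rcases i with i | i <;> rcases j with j | j <;> simp [M, B, C, D]
  rw [Matrix.det_fromBlocks₁₁] at hd
  have hd2 := (mul_eq_zero.1 hd).resolve_left hpq
  rw [Matrix.det_fin_one, Matrix.sub_apply, sub_eq_zero] at hd2
  simpa [D, B, Matrix.mul_apply] using hd2

theorem exists_deriv_mem (V : Submodule ℂ (ℝ → ℂ)) [FiniteDimensional ℂ V]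
    (hcont : ∀ v ∈ V, Continuous v) (htr : ∀ v ∈ V, ∀ t : ℝ, (fun s => v (t + s)) ∈ V) :
    ∀ v ∈ V, ∃ w ∈ V, ∀ x, HasDerivAt v (w x) x := by
  -- the subspace of differentiable functions with derivative in `V`
  let S : Submodule ℂ (ℝ → ℂ) :=
    { carrier := {v | v ∈ V ∧ ∃ w ∈ V, ∀ x, HasDerivAt v (w x) x}
      add_mem' := by
        rintro a b ⟨ha, w, hw, hd⟩ ⟨hb, w', hw', hd'⟩
        exact ⟨V.add_mem ha hb, w + w', V.add_mem hw hw', fun x => (hd x).add (hd' x)⟩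
      zero_mem' := ⟨V.zero_mem, 0, V.zero_mem, fun x => hasDerivAt_const x (0 : ℂ)⟩
      smul_mem' := by
        rintro c a ⟨ha, w, hw, hd⟩
        exact ⟨V.smul_mem c ha, c • w, V.smul_mem c hw, fun x => (hd x).const_smul c⟩ }
  have hSV : S ≤ V := fun v hv => hv.1
  have : FiniteDimensional ℂ S := Submodule.finiteDimensional_of_le hSV
  have hScl : IsClosed (S : Set (ℝ → ℂ)) := S.closed_of_finiteDimensional
  intro v hv
  have hvc := hcont v hv
  suffices h : v ∈ S from h.2
  -- averages
  have hI : ∀ ε : ℝ, (fun x => ∫ t in (0 : ℝ)..ε, v (t + x)) ∈ V := by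
    intro ε
    let b := Module.finBasis ℂ V
    let T : ℝ → V := fun t => ⟨fun s => v (t + s), htr v hv t⟩
    have hT : Continuous T := by
      refine Continuous.subtype_mk ?_ _
      exact continuous_pi fun s => hvc.comp (by fun_prop)
    have hcoef : ∀ i, Continuous fun t => b.repr (T t) i := by
      intro i
      have : Continuous (b.coord i) := LinearMap.continuous_of_finiteDimensional _
      exact this.comp hT
    have hrep : ∀ t x, v (t + x) = ∑ i, b.repr (T t) i * (b i : ℝ → ℂ) x := by
      intro t x
      have h1 := b.sum_repr (T t)
      have h2 := congrArg (fun u : V => (u : ℝ → ℂ) x) h1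
      simp only [Submodule.coe_sum, Submodule.coe_smul, Finset.sum_apply, Pi.smul_apply,
        smul_eq_mul] at h2
      exact h2.symm
    have : (fun x => ∫ t in (0 : ℝ)..ε, v (t + x))
        = ∑ i, (∫ t in (0 : ℝ)..ε, b.repr (T t) i) • (b i : ℝ → ℂ) := by
      ext x
      simp only [hrep, Finset.sum_apply, Pi.smul_apply, smul_eq_mul]
      rw [intervalIntegral.integral_finsetSum]
      · simp only [intervalIntegral.integral_mul_const]
      · intro i _
        exact ((hcoef i).mul continuous_const).intervalIntegrable _ _
    rw [this]
    exact V.sum_mem fun i _ => V.smul_mem _ (b i).2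
  have hIS : ∀ ε : ℝ, (fun x => ∫ t in (0 : ℝ)..ε, v (t + x)) ∈ S := by
    intro ε
    refine ⟨hI ε, fun x => v (ε + x) - v x, V.sub_mem (htr v hv ε) hv, fun x => ?_⟩
    have e : (fun x => ∫ t in (0 : ℝ)..ε, v (t + x))
        = fun x => (∫ t in (0 : ℝ)..(ε + x), v t) - ∫ t in (0 : ℝ)..x, v t := by
      ext x
      rw [intervalIntegral.integral_comp_add_right, zero_add,
        intervalIntegral.integral_interval_sub_left (hvc.intervalIntegrable _ _)
          (hvc.intervalIntegrable _ _)]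
    rw [e]
    have h1 : ∀ y, HasDerivAt (fun y => ∫ t in (0 : ℝ)..y, v t) (v y) y := fun y =>
      hvc.integral_hasStrictDerivAt 0 y |>.hasDerivAt
    exact ((h1 (ε + x)).comp_const_add ε x).sub (h1 x)
  have hlim : Filter.Tendsto (fun ε : ℝ => ((ε : ℂ)⁻¹) • (fun x => ∫ t in (0 : ℝ)..ε, v (t + x)))
      (nhdsWithin 0 {0}ᶜ) (nhds v) := by
    refine tendsto_pi_nhds.2 fun x => ?_
    have hc : Continuous fun t => v (t + x) := hvc.comp (by fun_prop)
    have h1 : HasDerivAt (fun y => ∫ t in (0 : ℝ)..y, v (t + x)) (v (0 + x)) 0 :=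
      hc.integral_hasStrictDerivAt 0 0 |>.hasDerivAt
    have h2 := h1.tendsto_slope
    rw [zero_add] at h2
    refine h2.congr fun ε => ?_
    simp [slope]
  exact hScl.mem_of_tendsto hlim (Filter.Eventually.of_forall fun ε => S.smul_mem _ (hIS ε))

theorem exists_antideriv (P : Polynomial ℂ) : ∃ Q : Polynomial ℂ, Polynomial.derivative Q = P := by
  induction P using Polynomial.induction_on' with
  | add p q hp hq =>
    obtain ⟨a, ha⟩ := hp
    obtain ⟨b, hb⟩ := hq
    exact ⟨a + b, by simp [ha, hb]⟩
  | monomial n a =>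
    refine ⟨Polynomial.monomial (n + 1) (a / (n + 1)), ?_⟩
    have : (n : ℂ) + 1 ≠ 0 := by exact_mod_cast Nat.succ_ne_zero n
    rw [Polynomial.derivative_monomial]
    simp [this]

theorem ode_step (μ : ℂ) (v w : ℝ → ℂ) (P : Polynomial ℂ) (hd : ∀ x, HasDerivAt v (w x) x)
    (h : ∀ x : ℝ, w x - μ * v x = P.eval (x : ℂ) * Complex.exp (μ * x)) :
    ∃ Q : Polynomial ℂ, ∀ x : ℝ, v x = Q.eval (x : ℂ) * Complex.exp (μ * x) := by
  obtain ⟨Q, hQ⟩ := exists_antideriv P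
  have hE : ∀ x : ℝ, HasDerivAt (fun x : ℝ => Complex.exp (-(μ * x)))
      (Complex.exp (-(μ * x)) * (-(μ * 1))) x := by
    intro x
    exact (((Complex.ofRealCLM.hasDerivAt (x := x)).const_mul μ).neg).cexp
  have hQd : ∀ x : ℝ, HasDerivAt (fun x : ℝ => Q.eval (x : ℂ)) (P.eval (x : ℂ)) x := by
    intro x
    rw [← hQ]
    exact (Q.hasDerivAt (x : ℂ)).comp_ofReal
  have hg : ∀ x : ℝ, HasDerivAt (fun x : ℝ => v x * Complex.exp (-(μ * x)) - Q.eval (x : ℂ)) 0 x := by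
    intro x
    refine (((hd x).mul (hE x)).sub (hQd x)).congr_deriv ?_
    have h1 : w x = μ * v x + P.eval (x : ℂ) * Complex.exp (μ * x) := by rw [← h x]; ring
    have h2 : Complex.exp (μ * x) * Complex.exp (-(μ * x)) = 1 := by
      rw [← Complex.exp_add]; simp
    rw [h1]
    linear_combination (P.eval (x : ℂ)) * h2
  have hconst := fun x : ℝ => is_const_of_deriv_eq_zero (fun x => (hg x).differentiableAt)
    (fun x => (hg x).deriv) x 0
  refine ⟨Q + Polynomial.C (v 0 - Q.eval 0), fun x => ?_⟩
  have h3 := hconst x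
  simp only [Complex.ofReal_zero, mul_zero, neg_zero, Complex.exp_zero, mul_one] at h3
  have h2 : Complex.exp (μ * x) * Complex.exp (-(μ * x)) = 1 := by
    rw [← Complex.exp_add]; simp
  simp only [Polynomial.eval_add, Polynomial.eval_C]
  linear_combination Complex.exp (μ * x) * h3 - v x * h2

/-- Exponential polynomials as a submodule. -/
def expPoly : Submodule ℂ (ℝ → ℂ) where
  carrier := {F | ∃ (m : ℕ) (lam : Fin m → ℂ) (P : Fin m → Polynomial ℂ),
        ∀ t : ℝ, F t = ∑ j, (P j).eval (t : ℂ) * Complex.exp (lam j * t)}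
  add_mem' := by
    rintro a b ⟨m, l, P, h⟩ ⟨m', l', P', h'⟩
    refine ⟨m + m', Fin.append l l', Fin.append P P', fun t => ?_⟩
    simp [Fin.sum_univ_add, h, h']
  zero_mem' := ⟨0, 0, 0, by simp⟩
  smul_mem' := by
    rintro c a ⟨m, l, P, h⟩
    refine ⟨m, l, fun j => Polynomial.C c * P j, fun t => ?_⟩
    simp [h, Finset.mul_sum, mul_assoc]

theorem mem_expPoly (V : Submodule ℂ (ℝ → ℂ)) [FiniteDimensional ℂ V]
    (hd : ∀ v ∈ V, ∃ w ∈ V, ∀ x, HasDerivAt v (w x) x) : V ≤ expPoly := by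
  choose! D hDV hD using hd
  let L : V →ₗ[ℂ] V :=
    { toFun := fun v => ⟨D v, hDV v v.2⟩
      map_add' := by
        intro a b
        ext x
        exact (hD _ (a + b).2 x).unique ((hD _ a.2 x).add (hD _ b.2 x))
      map_smul' := by
        intro c a
        ext x
        exact (hD _ (c • a).2 x).unique ((hD _ a.2 x).const_smul c) }
  have hgen : ∀ (μ : ℂ) (k : ℕ) (v : V), ((L - μ • (1 : Module.End ℂ V)) ^ k) v = 0 →
      ∃ Q : Polynomial ℂ, ∀ x : ℝ, (v : ℝ → ℂ) x = Q.eval (x : ℂ) * Complex.exp (μ * x) := by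
    intro μ k
    induction k with
    | zero =>
      intro v hv
      have : v = 0 := by simpa using hv
      exact ⟨0, by simp [this]⟩
    | succ k ih =>
      intro v hv
      rw [pow_succ, Module.End.mul_apply] at hv
      obtain ⟨P, hP⟩ := ih _ hv
      exact ode_step μ v (D v) P (hD v v.2) (fun x => by rw [← hP x]; simp [L])
  have htop := Module.End.iSup_maxGenEigenspace_eq_top L
  have hle : (⨆ μ : ℂ, Module.End.maxGenEigenspace L μ) ≤ expPoly.comap V.subtype := by
    refine iSup_le fun μ v hv => ?_
    obtain ⟨k, hk⟩ := (Module.End.mem_maxGenEigenspace L μ v).1 hv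
    obtain ⟨Q, hQ⟩ := hgen μ k v hk
    exact ⟨1, fun _ => μ, fun _ => Q, fun t => by simpa using hQ t⟩
  intro v hv
  rw [htop] at hle
  exact hle (Submodule.mem_top (x := (⟨v, hv⟩ : V)))

theorem translates_expPoly {F : ℝ → ℂ} (hF : Continuous F) {r : ℕ} (p : Fin r → ℝ)
    (hp : ∀ t : ℝ, ∃ c : Fin r → ℂ, ∀ s, F (t + s) = ∑ i, c i * F (p i + s)) :
    F ∈ expPoly := by
  let V : Submodule ℂ (ℝ → ℂ) := Submodule.span ℂ (Set.range fun t : ℝ => fun s => F (t + s))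
  let W : Submodule ℂ (ℝ → ℂ) := Submodule.span ℂ (Set.range fun i : Fin r => fun s => F (p i + s))
  have hVW : V ≤ W := by
    refine Submodule.span_le.2 ?_
    rintro _ ⟨t, rfl⟩
    obtain ⟨c, hc⟩ := hp t
    have : (fun s => F (t + s)) = ∑ i, c i • (fun s => F (p i + s)) := by
      ext s; simp [hc]
    change (fun s => F (t + s)) ∈ W
    rw [this]
    exact W.sum_mem fun i _ => W.smul_mem _ (Submodule.subset_span ⟨i, rfl⟩)
  have : FiniteDimensional ℂ W := FiniteDimensional.span_of_finite ℂ (Set.finite_range _)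
  have : FiniteDimensional ℂ V := Submodule.finiteDimensional_of_le hVW
  have hcont : ∀ v ∈ V, Continuous v := by
    intro v hv
    induction hv using Submodule.span_induction with
    | mem x hx =>
      obtain ⟨t, rfl⟩ := hx
      exact hF.comp (by fun_prop)
    | zero => exact continuous_const
    | add x y _ _ hx hy => exact hx.add hy
    | smul a x _ hx => exact hx.const_smul a
  have htr : ∀ v ∈ V, ∀ t : ℝ, (fun s => v (t + s)) ∈ V := by
    intro v hv t
    induction hv using Submodule.span_induction with
    | mem x hx =>
      obtain ⟨u, rfl⟩ := hx
      exact Submodule.subset_span ⟨u + t, by ext s; simp [add_assoc]⟩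
    | zero => exact V.zero_mem
    | add x y _ _ hx hy => exact V.add_mem hx hy
    | smul a x _ hx => exact V.smul_mem a hx
  refine mem_expPoly V (exists_deriv_mem V hcont htr) ?_
  exact Submodule.subset_span ⟨0, by ext s; simp⟩

/-- If a continuous `f : ℝ^d → ℂ` satisfies the Popoviciu–Ionescu functional equation of
order `n` in `ℝ^d`, then its restriction to any line is an exponential polynomial. -/
theorem stmt_6 (d n : ℕ) (f : (Fin d → ℝ) → ℂ) (hf : Continuous f)
    (heq : ∀ x h : Fin d → ℝ,
      Matrix.det (Matrix.of fun i j : Fin (n + 1) =>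
        f (x + ((i : ℕ) + (j : ℕ)) • h)) = 0) :
    ∀ x₀ h₀ : Fin d → ℝ,
      ∃ (m : ℕ) (lam : Fin m → ℂ) (P : Fin m → Polynomial ℂ),
        ∀ t : ℝ, f (x₀ + t • h₀) = ∑ j, (P j).eval (t : ℂ) * Complex.exp (lam j * t) := by
  intro x₀ h₀
  have hF : Continuous fun t : ℝ => f (x₀ + t • h₀) := hf.comp (by fun_prop)
  have hall := det_all hF (n := n) (fun x s => by
    rw [← heq (x₀ + x • h₀) (s • h₀)]
    congr 2
    ext i j
    congr 1
    rw [← Nat.cast_smul_eq_nsmul ℝ, smul_smul, add_assoc, ← add_smul]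
    push_cast
    rfl)
  obtain ⟨r, p, hp⟩ := exists_translates (F := fun t : ℝ => f (x₀ + t • h₀)) hall
  exact translates_expPoly hF p hp
end

section
/- Let f : ℝ → ℂ be a continuous function, let h_1, h_2 ∈ ℝ be nonzero with h_1/h_2 irrational, and suppose there are natural numbers n_1, n_2 such that dim span{f, τ_{h_1}(f), ..., (τ_{h_1})^{n_1}(f)} ≤ n_1 and dim span{f, τ_{h_2}(f), ..., (τ_{h_2})^{n_2}(f)} ≤ n_2. Then f is an exponential polynomial: there are finitely many λ_j ∈ ℂ and polynomials P_j ∈ ℂ[X] such that f(x) = Σ_j P_j(x)·exp(λ_j x) for all x ∈ ℝ. -/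
open scoped BigOperators

def IsEP (f : ℝ → ℂ) : Prop :=
  ∃ (m : ℕ) (lam : Fin m → ℂ) (P : Fin m → Polynomial ℂ),
      ∀ x : ℝ, f x = ∑ j, (P j).eval (x : ℂ) * Complex.exp (lam j * x)

theorem IsEP.zero : IsEP (fun _ => 0) := ⟨0, Fin.elim0, Fin.elim0, by simp⟩

theorem IsEP.add {f g : ℝ → ℂ} (hf : IsEP f) (hg : IsEP g) : IsEP (fun x => f x + g x) := by
  obtain ⟨m, l, P, h⟩ := hf
  obtain ⟨n, k, Q, h'⟩ := hg
  refine ⟨m + n, Fin.append l k, Fin.append P Q, fun x => ?_⟩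
  show f x + g x = _
  rw [h, h', Fin.sum_univ_add]
  simp

theorem exists_deriv_eq (p : Polynomial ℂ) : ∃ q : Polynomial ℂ, q.derivative = p := by
  induction p using Polynomial.induction_on' with
  | add p q hp hq =>
    obtain ⟨a, rfl⟩ := hp
    obtain ⟨b, rfl⟩ := hq
    exact ⟨a + b, by simp⟩
  | monomial n a =>
    refine ⟨Polynomial.monomial (n + 1) (a / (n + 1)), ?_⟩
    rw [Polynomial.derivative_monomial]
    have : ((n : ℂ) + 1) ≠ 0 := by exact_mod_cast Nat.succ_ne_zero n
    simp [this]

/-- A continuous one-parameter group in a Banach algebra is differentiable. -/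
theorem one_param_hasDerivAt {R : Type*} [NormedRing R] [NormedAlgebra ℝ R] [CompleteSpace R]
    (T : ℝ → R) (h0 : T 0 = 1) (hadd : ∀ s t, T (s + t) = T s * T t) (hc : Continuous T) :
    ∃ A : R, ∀ t, HasDerivAt T (T t * A) t := by
  set g : ℝ → R := fun s => ∫ u in (0 : ℝ)..s, T u with hg
  have hgd : ∀ s, HasDerivAt g (T s) s := fun s => hc.integral_hasStrictDerivAt 0 s |>.hasDerivAt
  have hg0 : g 0 = 0 := by simp [hg]
  obtain ⟨s, hs⟩ : ∃ s, IsUnit (g s) := by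
    have h1 := (hgd 0).tendsto_slope_zero
    rw [h0] at h1
    simp only [zero_add, hg0, sub_zero] at h1
    have h2 : ∀ᶠ x in nhds (1 : R), IsUnit x := Units.isOpen.mem_nhds isUnit_one
    have h3 := (h1.eventually h2).and self_mem_nhdsWithin
    obtain ⟨t, ht, ht0⟩ := h3.exists
    refine ⟨t, ?_⟩
    have ht0 : t ≠ 0 := ht0
    have := ht.smul (Units.mk0 t⁻¹ (inv_ne_zero ht0))⁻¹
    have e : (Units.mk0 t⁻¹ (inv_ne_zero ht0))⁻¹ • (t⁻¹ • g t) = g t := by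
      rw [Units.smul_def]; simp [smul_smul, ht0]
    rwa [e] at this
  obtain ⟨u, hu⟩ := hs
  have key : ∀ t, T t = (g (t + s) - g t) * (↑u⁻¹ : R) := by
    intro t
    rw [Units.eq_mul_inv_iff_mul_eq, hu]
    have e1 : g (t + s) - g t = ∫ v in t..(t + s), T v := by
      simp only [hg]
      exact intervalIntegral.integral_interval_sub_left (hc.intervalIntegrable _ _)
        (hc.intervalIntegrable _ _)
    have e2 : ∫ v in t..(t + s), T v = ∫ v in (0:ℝ)..s, T (t + v) := by
      rw [intervalIntegral.integral_comp_add_left (fun v => T v)]; simp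
    rw [e1, e2]
    simp only [hadd, hg]
    exact (ContinuousLinearMap.intervalIntegral_comp_comm (ContinuousLinearMap.mul ℝ R (T t))
      (hc.intervalIntegrable 0 s)).symm
  have hd : ∀ t, HasDerivAt T ((T (t + s) - T t) * (↑u⁻¹ : R)) t := by
    intro t
    have h1 : HasDerivAt (fun t => (g (t + s) - g t) * (↑u⁻¹ : R))
        ((T (t + s) - T t) * (↑u⁻¹ : R)) t :=
      (((hgd (t + s)).comp_add_const t s).sub (hgd t)).mul_const _
    exact h1.congr_of_eventuallyEq (Filter.Eventually.of_forall key)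
  refine ⟨(T s - 1) * (↑u⁻¹ : R), fun t => ?_⟩
  have := hd t
  rwa [hadd, show T t * T s - T t = T t * (T s - 1) by rw [mul_sub, mul_one], mul_assoc] at this

theorem one_param_EP {E : Type*} [NormedAddCommGroup E] [NormedSpace ℂ E] [FiniteDimensional ℂ E]
    (T : ℝ → (E →L[ℂ] E)) (h0 : T 0 = 1) (hadd : ∀ s t, T (s + t) = T s * T t)
    (hc : Continuous T) (l : E →L[ℂ] ℂ) (v : E) : IsEP (fun x => l (T x v)) := by
  have : CompleteSpace E := FiniteDimensional.complete ℂ E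
  obtain ⟨A, hA⟩ := one_param_hasDerivAt T h0 hadd hc
  have hd : ∀ v x, HasDerivAt (fun x => l (T x v)) (l (T x (A v))) x := by
    intro v x
    let L : (E →L[ℂ] E) →L[ℂ] ℂ := l.comp (ContinuousLinearMap.apply ℂ E v)
    have := (L.restrictScalars ℝ).hasFDerivAt.comp_hasDerivAt x (hA x)
    exact this
  have key : ∀ (μ : ℂ) (k : ℕ) (v : E), (((A : E →ₗ[ℂ] E) - algebraMap ℂ (Module.End ℂ E) μ) ^ k) v = 0 →
      ∃ P : Polynomial ℂ, ∀ x : ℝ, l (T x v) = P.eval (x : ℂ) * Complex.exp (μ * x) := by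
    intro μ k
    induction k with
    | zero => intro v hv; exact ⟨0, fun x => by simp at hv; simp [hv]⟩
    | succ k ih =>
      intro v hv
      rw [pow_succ] at hv
      obtain ⟨P, hP⟩ := ih _ hv
      obtain ⟨Q, rfl⟩ := exists_deriv_eq P
      have he : ∀ x : ℝ, HasDerivAt (fun x : ℝ => Complex.exp (-μ * x))
          (Complex.exp (-μ * x) * (-μ)) x := by
        intro x
        have := ((Complex.ofRealCLM.hasDerivAt (x := x)).const_mul (-μ)).cexp
        simpa using this
      have hq : ∀ x : ℝ, HasDerivAt (fun x : ℝ => Q.eval (x : ℂ)) (Q.derivative.eval (x : ℂ)) x :=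
        fun x => (Q.hasDerivAt (x : ℂ)).comp_ofReal
      have hw : ∀ x : ℝ, HasDerivAt (fun x : ℝ => l (T x v) * Complex.exp (-μ * x) - Q.eval (x : ℂ))
          0 x := by
        intro x
        have h1 := ((hd v x).mul (he x)).sub (hq x)
        refine h1.congr_deriv ?_
        symm
        have h2 := hP x
        have h3 : Complex.exp (μ * x) * Complex.exp (-μ * x) = 1 := by
          rw [← Complex.exp_add]; simp
        simp [Module.algebraMap_end_apply] at h2
        simp only [neg_mul] at h3 ⊢
        linear_combination (-Complex.exp (-(μ * x))) * h2 - (Polynomial.eval (x : ℂ) Q.derivative) * h3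
      have hcst := is_const_of_deriv_eq_zero (fun x => (hw x).differentiableAt)
        (fun x => (hw x).deriv)
      refine ⟨Q + Polynomial.C (l (T 0 v) * Complex.exp (-μ * (0:ℝ)) - Q.eval ((0:ℝ) : ℂ)), fun x => ?_⟩
      rw [← hcst x 0]
      have h3 : Complex.exp (-μ * x) * Complex.exp (μ * x) = 1 := by
        rw [← Complex.exp_add]; simp
      simp only [Polynomial.eval_add, Polynomial.eval_C]
      linear_combination (- l (T x v)) * h3
  have htop := Module.End.iSup_maxGenEigenspace_eq_top (A : Module.End ℂ E)
  have hv : v ∈ ⨆ μ, Module.End.maxGenEigenspace (A : E →ₗ[ℂ] E) μ := by rw [htop]; trivial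
  refine Submodule.iSup_induction _ (motive := fun v => IsEP (fun x => l (T x v))) hv ?_ ?_ ?_
  · intro μ v hv
    rw [Module.End.mem_maxGenEigenspace] at hv
    obtain ⟨k, hk⟩ := hv
    obtain ⟨P, hP⟩ := key μ k v (by
      rw [Algebra.algebraMap_eq_smul_one]; exact hk)
    exact ⟨1, fun _ => μ, fun _ => P, fun x => by simp [hP]⟩
  · simpa using IsEP.zero
  · intro v w hv hw
    simpa using hv.add hw

/-- Translation operator. -/
def sh (h : ℝ) : (ℝ → ℂ) →ₗ[ℂ] (ℝ → ℂ) := LinearMap.funLeft ℂ ℂ (fun x => x + h)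

theorem sh_apply (h : ℝ) (g : ℝ → ℂ) (x : ℝ) : sh h g x = g (x + h) := rfl

theorem sh_add (s t : ℝ) (g : ℝ → ℂ) : sh (s + t) g = sh s (sh t g) := by
  ext x; simp [sh_apply, add_assoc]

theorem sh_zero (g : ℝ → ℂ) : sh 0 g = g := by
  ext x; simp [sh_apply]

theorem sh_pow (h : ℝ) (k : ℕ) (g : ℝ → ℂ) (x : ℝ) : (sh h ^ k) g x = g (x + k * h) := by
  induction k generalizing x with
  | zero => simp
  | succ k ih =>
    rw [pow_succ', Module.End.mul_apply, sh_apply, ih]; push_cast; ring_nf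

theorem sh_comm (s t : ℝ) : Commute (sh s) (sh t) := by
  refine LinearMap.ext fun g => ?_
  ext x; simp [sh_apply]; ring_nf

theorem exists_fin_of_rank (f : ℝ → ℂ) (h : ℝ) (n : ℕ)
    (hdim : Module.rank ℂ ↥(Submodule.span ℂ
      (Set.range fun k : Fin (n + 1) => fun x : ℝ => f (x + (k : ℕ) * h))) ≤ n) :
    FiniteDimensional ℂ (Submodule.span ℂ (Set.range fun k : ℕ => (sh h ^ k) f)) := by
  have hnot : ¬ LinearIndependent ℂ (fun k : Fin (n + 1) => fun x : ℝ => f (x + (k : ℕ) * h)) := by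
    intro hl
    have := rank_span hl
    rw [this, Cardinal.mk_range_eq _ hl.injective] at hdim
    simp at hdim
  rw [Fintype.not_linearIndependent_iff] at hnot
  obtain ⟨c, hc, i, hi⟩ := hnot
  let p : Polynomial ℂ := ∑ k : Fin (n + 1), Polynomial.monomial (k : ℕ) (c k)
  have hp : p ≠ 0 := by
    intro h0
    apply hi
    have : p.coeff i = c i := by
      simp [p, Polynomial.coeff_monomial, Fin.val_inj]
    rw [← this, h0]; simp
  have hpf : Polynomial.aeval (sh h) p f = 0 := by
    rw [← hc]
    simp only [p, map_sum, LinearMap.sum_apply, Polynomial.aeval_monomial]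
    refine Finset.sum_congr rfl fun k _ => ?_
    ext x
    simp [sh_pow, Module.algebraMap_end_apply]
  have hle : Submodule.span ℂ (Set.range fun k : ℕ => (sh h ^ k) f) ≤
      Submodule.span ℂ (Set.range fun k : Fin (p.natDegree + 1) => (sh h ^ (k : ℕ)) f) := by
    rw [Submodule.span_le]
    rintro _ ⟨k, rfl⟩
    have e : (Polynomial.X ^ k : Polynomial ℂ) = (Polynomial.X ^ k / p) * p + Polynomial.X ^ k % p := by
      rw [mul_comm]; exact (EuclideanDomain.div_add_mod _ _).symm
    have e2 : (sh h ^ k) f = Polynomial.aeval (sh h) (Polynomial.X ^ k % p) f := by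
      have := congrArg (fun q => Polynomial.aeval (sh h) q f) e
      simpa [hpf] using this
    have hdeg : (Polynomial.X ^ k % p).natDegree < p.natDegree + 1 :=
      Nat.lt_succ_of_le (Polynomial.natDegree_le_natDegree (Polynomial.degree_mod_lt _ hp).le)
    simp only [SetLike.mem_coe]
    rw [e2, Polynomial.aeval_eq_sum_range' hdeg, LinearMap.sum_apply]
    refine Submodule.sum_mem _ fun i hi => ?_
    rw [LinearMap.smul_apply]
    exact Submodule.smul_mem _ _ (Submodule.subset_span ⟨⟨i, Finset.mem_range.1 hi⟩, rfl⟩)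
  have : FiniteDimensional ℂ
      (Submodule.span ℂ (Set.range fun k : Fin (p.natDegree + 1) => (sh h ^ (k : ℕ)) f)) :=
    FiniteDimensional.span_of_finite ℂ (Set.finite_range _)
  exact Submodule.finiteDimensional_of_le hle

theorem fin_invariant_EP (W : Submodule ℂ (ℝ → ℂ)) [FiniteDimensional ℂ W]
    (hcont : ∀ w ∈ W, Continuous w) (hinv : ∀ t, ∀ w ∈ W, sh t w ∈ W) (f : ℝ → ℂ) (hf : f ∈ W) :
    IsEP f := by
  let e : W ≃ₗ[ℂ] (Fin (Module.finrank ℂ W) → ℂ) := (Module.finBasis ℂ W).equivFun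
  let S : ℝ → (W →ₗ[ℂ] W) := fun t => (sh t).restrict (hinv t)
  let T : ℝ → ((Fin (Module.finrank ℂ W) → ℂ) →L[ℂ] (Fin (Module.finrank ℂ W) → ℂ)) := fun t =>
    LinearMap.toContinuousLinearMap (e.toLinearMap ∘ₗ S t ∘ₗ e.symm.toLinearMap)
  have hT : ∀ t v, T t v = e (S t (e.symm v)) := fun t v => rfl
  let l : (Fin (Module.finrank ℂ W) → ℂ) →L[ℂ] ℂ :=
    LinearMap.toContinuousLinearMap ((LinearMap.proj (0 : ℝ)) ∘ₗ W.subtype ∘ₗ e.symm.toLinearMap)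
  have hl : ∀ v, l v = (e.symm v : ℝ → ℂ) 0 := fun v => rfl
  have h := one_param_EP T ?_ ?_ ?_ l (e ⟨f, hf⟩)
  · convert h using 2 with x
    rw [hl, hT]
    simp [S, sh_apply]
  · ext1 v
    rw [hT]
    have : S 0 (e.symm v) = e.symm v := Subtype.ext (sh_zero _)
    rw [this]; simp
  · intro s t
    refine ContinuousLinearMap.ext fun v => ?_
    rw [show (T s * T t) v = T s (T t v) from rfl, hT, hT, hT, LinearEquiv.symm_apply_apply]
    congr 1
    exact Subtype.ext (sh_add _ _ _)
  · rw [continuous_clm_apply]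
    intro v
    have he : Continuous e := LinearMap.continuous_of_finiteDimensional e.toLinearMap
    refine he.comp ?_
    refine Continuous.subtype_mk (continuous_pi fun x => ?_) _
    exact (hcont _ (e.symm v).2).comp (continuous_const.add continuous_id)

/-- One-dimensional Montel-type theorem for Radó's equation: if `f : ℝ → ℂ` is continuous,
`h₁, h₂` are nonzero reals with irrational ratio, and the spans
`{f, τ_{h₁} f, …, (τ_{h₁})^{n₁} f}` and `{f, τ_{h₂} f, …, (τ_{h₂})^{n₂} f}` have dimensions
at most `n₁` and `n₂` respectively, then `f` is an exponential polynomial. -/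
theorem stmt_17 (f : ℝ → ℂ) (hf : Continuous f) (h₁ h₂ : ℝ)
    (hh₁ : h₁ ≠ 0) (hh₂ : h₂ ≠ 0) (hirr : Irrational (h₁ / h₂))
    (n₁ n₂ : ℕ)
    (hdim₁ : Module.rank ℂ ↥(Submodule.span ℂ
      (Set.range fun k : Fin (n₁ + 1) => fun x : ℝ => f (x + (k : ℕ) * h₁))) ≤ n₁)
    (hdim₂ : Module.rank ℂ ↥(Submodule.span ℂ
      (Set.range fun k : Fin (n₂ + 1) => fun x : ℝ => f (x + (k : ℕ) * h₂))) ≤ n₂) :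
    ∃ (m : ℕ) (lam : Fin m → ℂ) (P : Fin m → Polynomial ℂ),
      ∀ x : ℝ, f x = ∑ j, (P j).eval (x : ℂ) * Complex.exp (lam j * x) := by
  have fd1 := exists_fin_of_rank f h₁ n₁ hdim₁
  have fd2 := exists_fin_of_rank f h₂ n₂ hdim₂
  set W : Submodule ℂ (ℝ → ℂ) :=
    Submodule.span ℂ (Set.range fun q : ℕ × ℕ => (sh h₁ ^ q.1) ((sh h₂ ^ q.2) f)) with hW
  have hcomm : ∀ (i j : ℕ) (g : ℝ → ℂ), (sh h₁ ^ i) ((sh h₂ ^ j) g) = (sh h₂ ^ j) ((sh h₁ ^ i) g) :=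
    fun i j g => LinearMap.congr_fun ((sh_comm h₁ h₂).pow_pow i j).eq g
  have hfdW : FiniteDimensional ℂ W := by
    obtain ⟨s, hs⟩ := (Submodule.fg_iff_finiteDimensional _).2 fd1
    have hle : W ≤ ⨆ g : s, (Submodule.span ℂ (Set.range fun k : ℕ => (sh h₂ ^ k) (g : ℝ → ℂ))) := by
      rw [hW, Submodule.span_le]
      rintro _ ⟨⟨i, j⟩, rfl⟩
      have h1 : (sh h₁ ^ i) f ∈ Submodule.span ℂ (s : Set (ℝ → ℂ)) := by
        rw [hs]; exact Submodule.subset_span ⟨i, rfl⟩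
      have h2 : Submodule.span ℂ (s : Set (ℝ → ℂ)) ≤ Submodule.comap (sh h₂ ^ j)
          (⨆ g : s, (Submodule.span ℂ (Set.range fun k : ℕ => (sh h₂ ^ k) (g : ℝ → ℂ)))) := by
        rw [Submodule.span_le]
        intro g hg
        exact Submodule.mem_iSup_of_mem (⟨g, hg⟩ : s) (Submodule.subset_span ⟨j, rfl⟩)
      simp only [SetLike.mem_coe, hcomm]
      exact h2 h1
    have hfin : ∀ g : s, FiniteDimensional ℂ
        (Submodule.span ℂ (Set.range fun k : ℕ => (sh h₂ ^ k) (g : ℝ → ℂ))) := by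
      rintro ⟨g, hg⟩
      have hg' : g ∈ Submodule.span ℂ (Set.range fun k : ℕ => (sh h₁ ^ k) f) :=
        hs ▸ Submodule.subset_span hg
      show FiniteDimensional ℂ (Submodule.span ℂ (Set.range fun k : ℕ => (sh h₂ ^ k) g))
      clear hg
      induction hg' using Submodule.span_induction with
      | mem x hx =>
        obtain ⟨i, rfl⟩ := hx
        have : Submodule.span ℂ (Set.range fun k : ℕ => (sh h₂ ^ k) ((sh h₁ ^ i) f)) ≤
            (Submodule.span ℂ (Set.range fun k : ℕ => (sh h₂ ^ k) f)).map (sh h₁ ^ i) := by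
          rw [Submodule.span_le]
          rintro _ ⟨k, rfl⟩
          exact ⟨_, Submodule.subset_span ⟨k, rfl⟩, hcomm i k f⟩
        exact Submodule.finiteDimensional_of_le this
      | zero =>
        have : Submodule.span ℂ (Set.range fun k : ℕ => (sh h₂ ^ k) (0 : ℝ → ℂ)) ≤ ⊥ := by
          rw [Submodule.span_le]
          rintro _ ⟨k, rfl⟩
          simp
        exact Submodule.finiteDimensional_of_le this
      | add x y _ _ hx hy =>
        have : Submodule.span ℂ (Set.range fun k : ℕ => (sh h₂ ^ k) (x + y)) ≤
            Submodule.span ℂ (Set.range fun k : ℕ => (sh h₂ ^ k) x) ⊔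
            Submodule.span ℂ (Set.range fun k : ℕ => (sh h₂ ^ k) y) := by
          rw [Submodule.span_le]
          rintro _ ⟨k, rfl⟩
          simp only [map_add]
          exact Submodule.add_mem_sup (Submodule.subset_span ⟨k, rfl⟩)
            (Submodule.subset_span ⟨k, rfl⟩)
        exact Submodule.finiteDimensional_of_le this
      | smul a x _ hx =>
        have : Submodule.span ℂ (Set.range fun k : ℕ => (sh h₂ ^ k) (a • x)) ≤
            Submodule.span ℂ (Set.range fun k : ℕ => (sh h₂ ^ k) x) := by
          rw [Submodule.span_le]
          rintro _ ⟨k, rfl⟩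
          simp only [map_smul]
          exact Submodule.smul_mem _ _ (Submodule.subset_span ⟨k, rfl⟩)
        exact Submodule.finiteDimensional_of_le this
    exact Submodule.finiteDimensional_of_le hle
  have hcont : ∀ w ∈ W, Continuous w := by
    intro w hw
    induction hw using Submodule.span_induction with
    | mem x hx =>
      obtain ⟨q, rfl⟩ := hx
      have : (sh h₁ ^ q.1) ((sh h₂ ^ q.2) f) = fun x => f (x + q.1 * h₁ + q.2 * h₂) := by
        ext x; simp [sh_pow]
      simp only [this]
      fun_prop
    | zero => exact continuous_const
    | add x y _ _ hx hy => exact hx.add hy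
    | smul a x _ hx => exact hx.const_smul a
  let H : AddSubgroup ℝ :=
    { carrier := {t | ∀ w ∈ W, sh t w ∈ W}
      zero_mem' := fun w hw => by rwa [sh_zero]
      add_mem' := fun {a b} ha hb w hw => by rw [sh_add]; exact ha _ (hb _ hw)
      neg_mem' := fun {t} ht w hw => by
        have hinj : Function.Injective ((sh t).restrict ht) := by
          intro a b hab
          have h1 := congrArg (fun z : W => sh (-t) (z : ℝ → ℂ)) hab
          simp only [LinearMap.coe_restrict_apply, ← sh_add, neg_add_cancel, sh_zero] at h1
          exact Subtype.ext h1
        obtain ⟨z, hz⟩ := LinearMap.surjective_of_injective hinj ⟨w, hw⟩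
        have h1 : sh t (z : ℝ → ℂ) = w := congrArg Subtype.val hz
        rw [← h1, ← sh_add, neg_add_cancel, sh_zero]
        exact z.2 }
  have hmem : ∀ t, (∀ i j : ℕ, sh t ((sh h₁ ^ i) ((sh h₂ ^ j) f)) ∈ W) → t ∈ H := by
    intro t ht
    have : W ≤ W.comap (sh t) := by
      conv_lhs => rw [hW]
      rw [Submodule.span_le]
      rintro _ ⟨q, rfl⟩
      exact ht q.1 q.2
    exact fun w hw => this hw
  have hm1 : h₁ ∈ H := hmem _ fun i j => by
    refine Submodule.subset_span ⟨(i + 1, j), ?_⟩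
    simp only [pow_succ', Module.End.mul_apply]
  have hm2 : h₂ ∈ H := hmem _ fun i j => by
    refine Submodule.subset_span ⟨(i, j + 1), ?_⟩
    simp only [hcomm]
    simp only [pow_succ', Module.End.mul_apply]
  have hclosed : IsClosed (H : Set ℝ) := by
    have hWc : IsClosed (W : Set (ℝ → ℂ)) := Submodule.closed_of_finiteDimensional W
    have : (H : Set ℝ) = ⋂ w ∈ W, {t | sh t w ∈ (W : Set (ℝ → ℂ))} := by
      ext t; simp only [Set.mem_iInter]; rfl
    rw [this]
    refine isClosed_biInter fun w hw => hWc.preimage (continuous_pi fun x => ?_)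
    exact (hcont w hw).comp (continuous_const.add continuous_id)
  have hdense : Dense (H : Set ℝ) := by
    refine (dense_addSubgroupClosure_pair_iff.2 hirr).mono ?_
    rw [SetLike.coe_subset_coe, AddSubgroup.closure_le]
    rintro x (rfl | rfl)
    · exact hm1
    · exact hm2
  have huniv : (H : Set ℝ) = Set.univ := by
    rw [← hclosed.closure_eq]; exact hdense.closure_eq
  refine fin_invariant_EP W hcont (fun t => ?_) f (Submodule.subset_span ⟨(0, 0), by simp⟩)
  have : t ∈ (H : Set ℝ) := by rw [huniv]; trivial
  exact this
end
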